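/- Let $2 \leq d < \omega$ and suppose that for every finite coloring of any product of $d$ perfect Polish spaces there is a monochromatic set that is somewhere-DDF (i.e., $\mathsf{DDF}_d$ holds). Then $2^{\aleph_0} \geq \aleph_{d-1}$. -/

import Mathlib

/-- `IsDDF d X t U Z`: `Z ⊆ ∏_{i<d} U i` is a dense-by-dense-filter (DDF) set,
defined by recursion on `d`. For `d = 0` it means `Z` is nonempty; for `d + 1` it
means that `Z ⊆ ∏ U i`, the projection of `Z` to the first `d` coordinates is DDF,
and the fibers of `Z` over points of this projection generate a filter of subsets
of `X (last d)` that are dense in `U (last d)` (i.e. every finite intersection of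
fibers is dense in `U (last d)`). -/
def IsDDF : (d : ℕ) → (X : Fin d → Type) → (t : ∀ i, TopologicalSpace (X i)) →
    (U : ∀ i, Set (X i)) → (Z : Set (∀ i, X i)) → Prop
  | 0, _, _, _, Z => Z.Nonempty
  | (d + 1), X, t, U, Z =>
      Z ⊆ {f | ∀ i, f i ∈ U i} ∧
      IsDDF d (fun i => X i.castSucc) (fun i => t i.castSucc)
        (fun i => U i.castSucc) (Fin.init '' Z) ∧
      ∀ F : Finset (∀ i : Fin d, X i.castSucc), ↑F ⊆ Fin.init '' Z →
        U (Fin.last d) ⊆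
          @closure _ (t (Fin.last d)) {y | ∀ x ∈ F, Fin.snoc x y ∈ Z}

/-- `Z` is somewhere-DDF: for some nonempty open sets `U i ⊆ X i`, `Z` is a DDF
subset of `∏ U i`. -/
def SomewhereDDF (d : ℕ) (X : Fin d → Type) (t : ∀ i, TopologicalSpace (X i))
    (Z : Set (∀ i, X i)) : Prop :=
  ∃ U : ∀ i, Set (X i), (∀ i, @IsOpen _ (t i) (U i)) ∧ (∀ i, (U i).Nonempty) ∧
    IsDDF d X t U Z

open Filter Topology Cardinal

/-- A colouring of the `(m+1)`-st power of a set of size at most `ℵ_m`, together with a labelling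
by natural numbers, such that on each colour class the labelling is injective along the lines in
one fixed direction. -/
lemma exists_coloring_injective_on_lines (m : ℕ) :
    ∃ (κ : Type) (_ : Finite κ) (dir : κ → Fin (m + 1)), ∀ (X : Type) (S : Set X),
      #S ≤ ℵ_ m → ∃ (g : (Fin (m + 1) → X) → κ) (e : (Fin (m + 1) → X) → ℕ),
        ∀ x x' : Fin (m + 1) → X, (∀ i, x i ∈ S) → (∀ i, x' i ∈ S) → g x = g x' →
          (∀ j, j ≠ dir (g x) → x j = x' j) → e x = e x' → x = x' := by
  induction m with
  | zero =>
    refine ⟨Unit, inferInstance, fun _ => 0, fun X S hS => ?_⟩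
    have hc : S.Countable := by
      rw [← Cardinal.le_aleph0_iff_set_countable]
      simpa using hS
    obtain ⟨f, hf⟩ := Set.countable_iff_exists_injOn.1 hc
    refine ⟨fun _ => (), fun x => f (x 0), fun x x' hx hx' _ _ he => ?_⟩
    funext i
    rw [Fin.fin_one_eq_zero i]
    exact hf (hx 0) (hx' 0) he
  | succ m ih =>
    obtain ⟨κ, _, dir, h⟩ := ih
    refine ⟨Fin (m + 2) × κ, inferInstance, fun c => c.1.succAbove (dir c.2), fun X S hS => ?_⟩
    let W : Type := (ℵ_ ((m + 1 : ℕ) : Ordinal)).ord.ToType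
    have hW : #S ≤ #W := by simpa [W] using hS
    obtain ⟨f⟩ := hW
    have hseg : ∀ w : W, #{y : X | ∃ hy : y ∈ S, f ⟨y, hy⟩ ≤ w} ≤ ℵ_ m := by
      intro w
      have h1 : #{y : X | ∃ hy : y ∈ S, f ⟨y, hy⟩ ≤ w} ≤ #(Set.Iic w) := by
        refine Cardinal.mk_le_of_injective
          (f := fun y => (⟨f ⟨y.1, y.2.choose⟩, y.2.choose_spec⟩ : Set.Iic w)) ?_
        intro y y' hyy
        have := f.injective (Subtype.ext_iff.1 hyy)
        exact Subtype.ext (congrArg (fun s : S => (s : X)) this)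
      have h2 : #(Set.Iic w) < ℵ_ ((m + 1 : ℕ) : Ordinal) := by
        have hlt : #(Set.Iio w) < ℵ_ ((m + 1 : ℕ) : Ordinal) := by
          simpa [W] using Cardinal.mk_Iio_lt w (by simp [W])
        rw [← Set.Iio_insert]
        refine (Cardinal.mk_insert_le).trans_lt ?_
        exact Cardinal.add_lt_of_lt (Cardinal.aleph0_le_aleph _) hlt
          (Cardinal.one_lt_aleph0.trans_le (Cardinal.aleph0_le_aleph _))
      have h3 : ℵ_ ((m + 1 : ℕ) : Ordinal) = Order.succ (ℵ_ m) := by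
        rw [Cardinal.succ_aleph]; simp
      exact h1.trans (Order.lt_succ_iff.1 (h3 ▸ h2))
    choose g e hge using fun w => h X _ (hseg w)
    have hmax : ∀ x : Fin (m + 2) → X, ∃ p, ∀ hx : ∀ i, x i ∈ S,
        ∀ i, f ⟨x i, hx i⟩ ≤ f ⟨x p, hx p⟩ := by
      intro x
      by_cases hx : ∀ i, x i ∈ S
      · obtain ⟨p, hp⟩ := Finite.exists_max fun i => f ⟨x i, hx i⟩
        exact ⟨p, fun _ => hp⟩
      · exact ⟨0, fun h => absurd h hx⟩
    choose p hp using hmax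
    have : Nonempty W := by
      by_contra hne
      rw [not_nonempty_iff, ← Cardinal.mk_eq_zero_iff] at hne
      exact (Cardinal.aleph_pos _).ne' (by simpa [W] using hne)
    let f' : X → W := fun y => open Classical in
      if hy : y ∈ S then f ⟨y, hy⟩ else Classical.arbitrary W
    have hf' : ∀ y (hy : y ∈ S), f' y = f ⟨y, hy⟩ := fun y hy => dif_pos hy
    refine ⟨fun x => (p x, g (f' (x (p x))) fun j => x ((p x).succAbove j)),
      fun x => e (f' (x (p x))) fun j => x ((p x).succAbove j), ?_⟩
    intro x x' hx hx' hg hline he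
    simp only [Prod.mk.injEq] at hg hline he
    obtain ⟨hpp, hg⟩ := hg
    have hpx := hp x hx
    have hpx' := hp x' hx'
    rw [← hpp] at hg he
    simp only [← hpp] at hpx'
    generalize p x = q at *
    have hq : x q = x' q := hline q (Fin.succAbove_ne _ _).symm
    rw [← hq] at hg he
    have key := hge _ _ _ (fun j => ⟨hx _, by rw [hf' _ (hx q)]; exact hpx _⟩)
      (fun j => ⟨hx' _, by
        rw [hf' _ (hx q)]; simpa only [hq] using hpx' (q.succAbove j)⟩) hg
      (fun j hj => hline _ fun hh => hj (Fin.succAbove_right_injective hh)) he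
    funext i
    rcases Fin.eq_self_or_eq_succAbove q i with rfl | ⟨j, rfl⟩
    · exact hq
    · exact congrFun key j

lemma IsDDF.nonempty : ∀ {d : ℕ} {X : Fin d → Type} {t : ∀ i, TopologicalSpace (X i)}
    {U : ∀ i, Set (X i)} {Z : Set (∀ i, X i)}, IsDDF d X t U Z → Z.Nonempty
  | 0, _, _, _, _, h => h
  | _ + 1, _, _, _, _, h => (IsDDF.nonempty h.2.1).of_image

/-- A DDF set contains arbitrarily large finite subsets of lines in any given direction. -/
lemma IsDDF.exists_finset_on_line {Y : Type} [t : TopologicalSpace Y] [T1Space Y]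
    (hY : ∀ U : Set Y, IsOpen U → U.Nonempty → U.Infinite) (N : ℕ) :
    ∀ {d : ℕ} {U : Fin d → Set Y} {Z : Set (Fin d → Y)}, (∀ i, IsOpen (U i)) →
      (∀ i, (U i).Nonempty) → IsDDF d (fun _ => Y) (fun _ => t) U Z → ∀ i : Fin d,
      ∃ F : Finset (Fin d → Y), ↑F ⊆ Z ∧ F.card = N ∧
        ∀ x ∈ F, ∀ x' ∈ F, ∀ j, j ≠ i → x j = x' j
  | 0, _, _, _, _, _, i => i.elim0
  | d + 1, U, Z, hU, hne, h, i => by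
    obtain ⟨-, hinit, hfib⟩ := h
    have snoc_inj : ∀ w : Fin d → Y,
        Function.Injective fun y => (Fin.snoc w y : Fin (d + 1) → Y) := by
      intro w y y' hy
      simpa using congrFun hy (Fin.last d)
    classical
    induction i using Fin.lastCases with
    | last =>
      obtain ⟨w, hw⟩ := hinit.nonempty
      have hcl := hfib {w} (by simpa using hw)
      have hinf : {y | ∀ x ∈ ({w} : Finset (Fin d → Y)),
          (Fin.snoc x y : Fin (d + 1) → Y) ∈ Z}.Infinite := by
        intro hfin
        have hcl' := hcl
        erw [hfin.isClosed.closure_eq] at hcl'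
        exact hY _ (hU _) (hne _) (hfin.subset hcl')
      obtain ⟨F, hF, hcard⟩ := hinf.exists_subset_card_eq N
      refine ⟨F.image fun y => Fin.snoc w y, ?_, ?_, ?_⟩
      · intro x hx
        simp only [Finset.coe_image, Set.mem_image] at hx
        obtain ⟨y, hy, rfl⟩ := hx
        exact hF hy w (Finset.mem_singleton_self w)
      · rw [Finset.card_image_of_injective _ (snoc_inj w), hcard]
      · simp only [Finset.mem_image]
        rintro _ ⟨y, -, rfl⟩ _ ⟨y', -, rfl⟩ j hj
        induction j using Fin.lastCases with
        | last => exact absurd rfl hj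
        | cast j => simp
    | cast i =>
      obtain ⟨F, hF, hcard, hline⟩ := IsDDF.exists_finset_on_line hY N
        (fun i => hU i.castSucc) (fun i => hne i.castSucc) hinit i
      obtain ⟨y, hy⟩ := closure_nonempty_iff.1 ((hne (Fin.last d)).mono (hfib F hF))
      refine ⟨F.image fun x => Fin.snoc x y, ?_, ?_, ?_⟩
      · intro x hx
        simp only [Finset.coe_image, Set.mem_image] at hx
        obtain ⟨w, hw, rfl⟩ := hx
        exact hy w hw
      · rw [Finset.card_image_of_injective, hcard]
        intro x x' hx
        simpa using congrArg Fin.init hx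
      · simp only [Finset.mem_image]
        rintro _ ⟨x, hx, rfl⟩ _ ⟨x', hx', rfl⟩ j hj
        induction j using Fin.lastCases with
        | last => simp
        | cast j =>
          simpa using hline x hx x' hx' j fun hji => hj (congrArg Fin.castSucc hji)

lemma tendsto_update_atTop {Y : Type*} [TopologicalSpace Y] (x : ℕ → Y) (b : ℕ → Y) :
    Tendsto (fun n => Function.update x n (b n)) atTop (𝓝 x) := by
  refine tendsto_pi_nhds.2 fun k => tendsto_const_nhds.congr' ?_
  filter_upwards [eventually_gt_atTop k] with n hn
  rw [Function.update_of_ne hn.ne]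

lemma neBot_nhdsNE_cantor (x : ℕ → Bool) : (𝓝[≠] x).NeBot := by
  refine (tendsto_nhdsWithin_iff.2 ⟨tendsto_update_atTop x fun n => !x n, ?_⟩).neBot
  refine Eventually.of_forall fun n hn => ?_
  simpa using congrFun hn n

lemma perfect_univ_cantor : Perfect (Set.univ : Set (ℕ → Bool)) :=
  ⟨isClosed_univ, fun x _ => by simpa [AccPt] using neBot_nhdsNE_cantor x⟩

lemma infinite_of_isOpen_cantor (U : Set (ℕ → Bool)) (hU : IsOpen U) (hne : U.Nonempty) :
    U.Infinite := by
  obtain ⟨x, hx⟩ := hne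
  have := neBot_nhdsNE_cantor x
  exact infinite_of_mem_nhds x (hU.mem_nhds hx)

/-- Only finitely many coordinates can be constant on a dense subset of a given nonempty open set
of the Cantor space. -/
lemma exists_bound_of_subset_closure_cantor {U : Set (ℕ → Bool)} (hU : IsOpen U)
    (hne : U.Nonempty) (b : Bool) :
    ∃ N, ∀ n, U ⊆ closure {y | y n = b} → n < N := by
  obtain ⟨x, hx⟩ := hne
  obtain ⟨N, hN⟩ := eventually_atTop.1
    ((tendsto_update_atTop x fun _ => !b).eventually (hU.mem_nhds hx))
  refine ⟨N, fun n hn => ?_⟩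
  by_contra! hle
  have hcl : IsClosed {y : ℕ → Bool | y n = b} :=
    isClosed_eq (continuous_apply n) continuous_const
  rw [hcl.closure_eq] at hn
  simpa using hn (hN n hle)

/-- If `DDF_d` holds — every finite coloring of any product of `d` perfect Polish
spaces has a monochromatic somewhere-DDF set — then `2^{ℵ₀} ≥ ℵ_{d-1}`. -/
theorem stmt12 (d : ℕ) (hd : 2 ≤ d)
    (hDDF : ∀ (X : Fin d → Type) (t : ∀ i, TopologicalSpace (X i)),
      (∀ i, @PolishSpace (X i) (t i)) →
      (∀ i, @Perfect (X i) (t i) Set.univ) →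
      (∀ i, Nonempty (X i)) →
      ∀ (r : ℕ) (γ : (∀ i, X i) → Fin r),
        ∃ (j : Fin r) (Z : Set (∀ i, X i)),
          SomewhereDDF d X t Z ∧ Z ⊆ γ ⁻¹' {j}) :
    Cardinal.aleph (d - 1) ≤ Cardinal.continuum := by
  obtain ⟨m, rfl⟩ := Nat.exists_eq_add_of_le' hd
  have hidx : (((m + 2 : ℕ) : Ordinal) - 1) = (m : Ordinal) + 1 := by
    rw [← Nat.cast_one, ← Ordinal.natCast_sub]
    simp
  rw [hidx]
  by_contra! hlt
  rw [← Cardinal.succ_aleph, Order.lt_succ_iff] at hlt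
  have hle : (𝔠 : Cardinal.{0}) ≤ ℵ_ m := by
    rw [← Cardinal.lift_le, Cardinal.lift_continuum, Cardinal.lift_aleph]
    simpa using hlt
  obtain ⟨κ, _, dir, h⟩ := exists_coloring_injective_on_lines m
  obtain ⟨g, e, hge⟩ := h (ℕ → Bool) Set.univ (by simpa using hle)
  obtain ⟨r, ⟨φ⟩⟩ := Finite.exists_equiv_fin (κ × Bool)
  obtain ⟨c, Z, ⟨U, hU, hne, -, hinit, hfib⟩, hZ⟩ := hDDF (fun _ => ℕ → Bool)
    (fun _ => inferInstance) (fun _ => { }) (fun _ => perfect_univ_cantor)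
    (fun _ => inferInstance) r
    fun x => φ (g (Fin.init x), x (Fin.last _) (e (Fin.init x)))
  have hcol : ∀ x ∈ Z, g (Fin.init x) = (φ.symm c).1 ∧
      x (Fin.last _) (e (Fin.init x)) = (φ.symm c).2 := by
    intro x hx
    have := hZ hx
    simp only [Set.mem_preimage, Set.mem_singleton_iff] at this
    simp [← this]
  obtain ⟨N, hN⟩ := exists_bound_of_subset_closure_cantor (hU (Fin.last _)) (hne _) (φ.symm c).2
  obtain ⟨F, hF, hcard, hline⟩ := IsDDF.exists_finset_on_line infinite_of_isOpen_cantor (N + 1)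
    (fun i => hU i.castSucc) (fun i => hne i.castSucc) hinit (dir (φ.symm c).1)
  have hg : ∀ w ∈ F, g w = (φ.symm c).1 := by
    intro w hw
    obtain ⟨x, hx, rfl⟩ := hF hw
    exact (hcol x hx).1
  have he : ∀ w ∈ F, e w < N := by
    intro w hw
    refine hN _ ((hfib {w} (by simpa using hF hw)).trans (closure_mono fun y hy => ?_))
    simpa using (hcol _ (hy w (Finset.mem_singleton_self w))).2
  have hcard_le : F.card ≤ (Finset.range N).card := by
    refine Finset.card_le_card_of_injOn e (fun w hw => by simpa using he w hw) ?_
    intro w hw w' hw' hww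
    refine hge w w' (fun _ => trivial) (fun _ => trivial) ((hg w hw).trans (hg w' hw').symm) ?_ hww
    rw [hg w hw]
    exact hline w hw w' hw'
  rw [hcard, Finset.card_range] at hcard_le
  omega
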